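/- In êP'(ℂ), the following identities hold for every point (x;p,q) ∈ 𝓒 and all integers p', q', s (where [x,r,s] denotes the class of the point of 𝓒 over the same point of P with fiber coordinates (r,s)): (i) [x,p,q] - [x,p,q'] = [x,p,q-1] - [x,p,q'-1]; (ii) [x,p,q] - [x,p',q] = [x,p-1,q] - [x,p'-1,q]; (iii) [x,p,q] - [x,p+s,q-s] = [x,p+1,q-1] - [x,p+s+1,q-s-1]. -/

import Mathlib

open Complex
open scoped Classical

noncomputable section

namespace ExtendedBloch

/-- `π` as a complex number. -/
def Cpi : ℂ := (Real.pi : ℂ)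

/-- Membership in `ℂ ∖ {0,1}`. -/
def Reg (z : ℂ) : Prop := z ≠ 0 ∧ z ≠ 1

/-- The open upper half plane. -/
def UHP : Set ℂ := {z : ℂ | 0 < z.im}

/-- The 5-tuple occurring in the five term relation. -/
def ftTuple (x y : ℂ) : Fin 5 → ℂ :=
  ![x, y, y / x, (1 - x⁻¹) / (1 - y⁻¹), (1 - x) / (1 - y)]

/-- The set `FT` of five term tuples. -/
def FT : Set (Fin 5 → ℂ) :=
  {v | ∃ x y : ℂ, Reg x ∧ Reg y ∧ x ≠ y ∧ v = ftTuple x y}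

/-- The subset `FT⁺` of tuples with all coordinates in the upper half plane. -/
def FTplus : Set (Fin 5 → ℂ) := {v | v ∈ FT ∧ ∀ i, v i ∈ UHP}

/-- The point `(z; p, q)` of the cover `𝓒` of `ℂ ∖ {0,1}`, realized concretely as the pair of
branch values `(log z + pπi, -log(1-z) + qπi)` (Riemann surface model of `𝓒`). -/
def pt (z : ℂ) (p q : ℤ) : ℂ × ℂ :=
  (Complex.log z + p * (Cpi * I), -Complex.log (1 - z) + q * (Cpi * I))

/-- The cover `𝓒`, realized as the Riemann surface of all branches of
`(log z + pπi, -log(1-z) + qπi)` on `ℂ ∖ {0,1}`. -/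
def Cover : Set (ℂ × ℂ) := {w | ∃ z : ℂ, Reg z ∧ ∃ p q : ℤ, w = pt z p q}

lemma pt_mem_Cover {z : ℂ} (h : Reg z) (p q : ℤ) : pt z p q ∈ Cover :=
  ⟨z, h, p, q, rfl⟩

/-- `w ∈ 𝓒` lies over `z ∈ ℂ ∖ {0,1}`. -/
def LiesOver (w : ℂ × ℂ) (z : ℂ) : Prop := Reg z ∧ ∃ p q : ℤ, w = pt z p q

/-- The covering action of `ℤ × ℤ` on `𝓒`. -/
def covAct (v : ℤ × ℤ) (w : ℂ × ℂ) : ℂ × ℂ :=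
  (w.1 + v.1 * (Cpi * I), w.2 + v.2 * (Cpi * I))

/-- The subset `V ⊂ (ℤ × ℤ)⁵`. -/
def Vset : Set (Fin 5 → ℤ × ℤ) :=
  {v | ∃ p₀ p₁ q₀ q₁ q₂ : ℤ,
    v = ![(p₀, q₀), (p₁, q₁), (p₁ - p₀, q₂), (p₁ - p₀ + q₁ - q₀, q₂ - q₁),
          (q₁ - q₀, q₂ - q₁ - p₀)]}

/-- The preimage of `FT` in `𝓒⁵`. -/
def FTpre : Set (Fin 5 → ℂ × ℂ) := {w | ∃ v ∈ FT, ∀ i, LiesOver (w i) (v i)}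

/-- A base point `((x₀;0,0),…,(x₄;0,0))` with `(x₀,…,x₄) ∈ FT⁺`. -/
def basePt : Fin 5 → ℂ × ℂ := fun i => pt (ftTuple ((1 + I) / 4) I i) 0 0

/-- `𝓕𝓣̂₀`: the connected component of the preimage of `FT` in `𝓒⁵` containing the points
`((x₀;0,0),…,(x₄;0,0))` with `(x₀,…,x₄) ∈ FT⁺`. -/
def FThat₀ : Set (Fin 5 → ℂ × ℂ) := connectedComponentIn FTpre basePt

/-- `𝓕𝓣̂ = 𝓕𝓣̂₀ + V`. -/
def FThat : Set (Fin 5 → ℂ × ℂ) :=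
  {u | ∃ w ∈ FThat₀, ∃ v ∈ Vset, u = fun i => covAct (v i) (w i)}

abbrev CoverT : Type := ↥Cover

/-- The generator `(z; p, q)` of the free abelian group on `𝓒`. -/
def genOf (z : ℂ) (h : Reg z) (p q : ℤ) : FreeAbelianGroup CoverT :=
  FreeAbelianGroup.of ⟨pt z p q, pt_mem_Cover h p q⟩

/-- The lifted five term relators. -/
def FiveTermRels : Set (FreeAbelianGroup CoverT) :=
  {a | ∃ w : Fin 5 → ℂ × ℂ, w ∈ FThat ∧ ∃ hc : ∀ i, w i ∈ Cover,
    a = ∑ i : Fin 5, (-1 : ℤ) ^ (i : ℕ) • FreeAbelianGroup.of (⟨w i, hc i⟩ : CoverT)}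

/-- The transfer relators. -/
def TransferRels : Set (FreeAbelianGroup CoverT) :=
  {a | ∃ z : ℂ, ∃ h : Reg z, ∃ p q p' q' : ℤ,
    a = genOf z h p q + genOf z h p' q' - genOf z h p q' - genOf z h p' q}

def relSub : AddSubgroup (FreeAbelianGroup CoverT) :=
  AddSubgroup.closure (FiveTermRels ∪ TransferRels)

def relSub' : AddSubgroup (FreeAbelianGroup CoverT) :=
  AddSubgroup.closure FiveTermRels

/-- The extended pre-Bloch group `êP(ℂ)`. -/
abbrev EPreBloch : Type := FreeAbelianGroup CoverT ⧸ relSub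

/-- The variant `êP'(ℂ)` without the transfer relations. -/
abbrev EPreBloch' : Type := FreeAbelianGroup CoverT ⧸ relSub'

/-- The class `[z, p, q] ∈ êP(ℂ)` (junk value `0` if `z ∈ {0,1}`). -/
def cls (z : ℂ) (p q : ℤ) : EPreBloch :=
  if h : Reg z then QuotientAddGroup.mk (genOf z h p q) else 0

/-- The class `[z, p, q] ∈ êP'(ℂ)` (junk value `0` if `z ∈ {0,1}`). -/
def cls' (z : ℂ) (p q : ℤ) : EPreBloch' :=
  if h : Reg z then QuotientAddGroup.mk (genOf z h p q) else 0

/-- `ℂ ∧_ℤ ℂ`, the second exterior power of `ℂ` as a `ℤ`-module. -/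
abbrev L2C : Type := ↥(⋀[ℤ]^2 ℂ)

/-- The wedge `a ∧ b ∈ ℂ ∧_ℤ ℂ`. -/
def wedge (a b : ℂ) : L2C :=
  ⟨ExteriorAlgebra.ιMulti ℤ 2 ![a, b],
   ExteriorAlgebra.ιMulti_range ℤ 2 (Set.mem_range_self _)⟩

def nuFree : FreeAbelianGroup CoverT →+ L2C :=
  FreeAbelianGroup.lift fun w : CoverT => wedge w.1.1 w.1.2

/-- The homomorphism `ν : êP(ℂ) → ℂ ∧_ℤ ℂ`. -/
def nuHom : EPreBloch →+ L2C :=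
  if h : ∀ a ∈ relSub, nuFree a = 0 then QuotientAddGroup.lift relSub nuFree h else 0

/-- The homomorphism `ν : êP'(ℂ) → ℂ ∧_ℤ ℂ`. -/
def nuHom' : EPreBloch' →+ L2C :=
  if h : ∀ a ∈ relSub', nuFree a = 0 then QuotientAddGroup.lift relSub' nuFree h else 0

/-- The extended Bloch group `êB(ℂ) = ker ν`. -/
def EBloch : AddSubgroup EPreBloch := nuHom.ker

/-- `êB'(ℂ) = ker ν` on `êP'(ℂ)`. -/
def EBloch' : AddSubgroup EPreBloch' := nuHom'.ker

/-- The component `X₀₀` of `𝓒` (both fiber coordinates even). -/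
def X00 : Set (ℂ × ℂ) := {w | ∃ z : ℂ, Reg z ∧ ∃ p q : ℤ, w = pt z (2 * p) (2 * q)}

abbrev X00T : Type := ↥X00

lemma pt_mem_X00 {z : ℂ} (h : Reg z) (p q : ℤ) : pt z (2 * p) (2 * q) ∈ X00 :=
  ⟨z, h, p, q, rfl⟩

/-- The generator `(z; 2p, 2q)` of the free abelian group on `X₀₀`. -/
def genOf₀ (z : ℂ) (h : Reg z) (p q : ℤ) : FreeAbelianGroup X00T :=
  FreeAbelianGroup.of ⟨pt z (2 * p) (2 * q), pt_mem_X00 h p q⟩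

/-- The five term relators coming from `𝓕𝓣̂ ∩ (X₀₀)⁵`. -/
def FiveTermRels₀ : Set (FreeAbelianGroup X00T) :=
  {a | ∃ w : Fin 5 → ℂ × ℂ, w ∈ FThat ∧ ∃ hc : ∀ i, w i ∈ X00,
    a = ∑ i : Fin 5, (-1 : ℤ) ^ (i : ℕ) • FreeAbelianGroup.of (⟨w i, hc i⟩ : X00T)}

def relSub₀ : AddSubgroup (FreeAbelianGroup X00T) := AddSubgroup.closure FiveTermRels₀

/-- The true extended pre-Bloch group `êêP(ℂ)`. -/
abbrev EEPreBloch : Type := FreeAbelianGroup X00T ⧸ relSub₀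

/-- The class `[z, 2p, 2q] ∈ êêP(ℂ)` (junk value `0` if `z ∈ {0,1}`). -/
def cls₀ (z : ℂ) (p q : ℤ) : EEPreBloch :=
  if h : Reg z then QuotientAddGroup.mk (genOf₀ z h p q) else 0

def nuFree₀ : FreeAbelianGroup X00T →+ L2C :=
  FreeAbelianGroup.lift fun w : X00T => wedge w.1.1 w.1.2

/-- The homomorphism `ν̂ : êêP(ℂ) → ℂ ∧_ℤ ℂ`. -/
def nuHom₀ : EEPreBloch →+ L2C :=
  if h : ∀ a ∈ relSub₀, nuFree₀ a = 0 then QuotientAddGroup.lift relSub₀ nuFree₀ h else 0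

/-- The true extended Bloch group `êêB(ℂ) = ker ν̂`. -/
def EEBloch : AddSubgroup EEPreBloch := nuHom₀.ker

/-- The Rogers dilogarithm `𝓡(z) = ½ log z log(1-z) - ∫₀ᶻ log(1-t)/t dt` (straight segment,
parametrized by `t = s z`). -/
def rogers (z : ℂ) : ℂ :=
  (1 / 2) * Complex.log z * Complex.log (1 - z) -
    ∫ s in (0:ℝ)..(1:ℝ), Complex.log (1 - (s : ℂ) * z) / (s : ℂ)

/-- `R(z; p, q) = 𝓡(z) + (πi/2)(p log(1-z) + q log z) - π²/6`. -/
def Rfun (z : ℂ) (p q : ℤ) : ℂ :=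
  rogers z + (Cpi * I / 2) * (p * Complex.log (1 - z) + q * Complex.log z) - Cpi ^ 2 / 6

/-- `R̂(z; 2p, 2q) = 𝓡(z) + πi(p log(1-z) + q log z) - π²/6`. -/
def Rhat (z : ℂ) (p q : ℤ) : ℂ :=
  rogers z + Cpi * I * (p * Complex.log (1 - z) + q * Complex.log z) - Cpi ^ 2 / 6

/-- `ℂ / π²ℤ`. -/
abbrev ModPiSq : Type := ℂ ⧸ AddSubgroup.zmultiples (Cpi ^ 2)

/-- `ℂ / 2π²ℤ`. -/
abbrev Mod2PiSq : Type := ℂ ⧸ AddSubgroup.zmultiples (2 * Cpi ^ 2)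

abbrev RegT : Type := {z : ℂ // Reg z}

def pbGen (z : ℂ) (h : Reg z) : FreeAbelianGroup RegT := FreeAbelianGroup.of ⟨z, h⟩

/-- The five term relators for the classical pre-Bloch group. -/
def pbRels : Set (FreeAbelianGroup RegT) :=
  {a | ∃ x y : ℂ, ∃ hx : Reg x, ∃ hy : Reg y, x ≠ y ∧
    ∃ h2 : Reg (y / x), ∃ h3 : Reg ((1 - x⁻¹) / (1 - y⁻¹)), ∃ h4 : Reg ((1 - x) / (1 - y)),
    a = pbGen x hx - pbGen y hy + pbGen (y / x) h2 -
        pbGen ((1 - x⁻¹) / (1 - y⁻¹)) h3 + pbGen ((1 - x) / (1 - y)) h4}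

def pbSub : AddSubgroup (FreeAbelianGroup RegT) := AddSubgroup.closure pbRels

/-- The classical pre-Bloch group `P(ℂ)`. -/
abbrev PreBloch : Type := FreeAbelianGroup RegT ⧸ pbSub

/-- The class `[z] ∈ P(ℂ)` (junk value `0` if `z ∈ {0,1}`). -/
def pbCls (z : ℂ) : PreBloch :=
  if h : Reg z then QuotientAddGroup.mk (pbGen z h) else 0

/-- `ℂ* ∧_ℤ ℂ*`, the second exterior power of the multiplicative group `ℂ*` as `ℤ`-module. -/
abbrev L2CU : Type := ↥(⋀[ℤ]^2 (Additive ℂˣ))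

/-- The wedge `a ∧ b ∈ ℂ* ∧_ℤ ℂ*`. -/
def wedgeU (a b : ℂˣ) : L2CU :=
  ⟨ExteriorAlgebra.ιMulti ℤ 2 ![Additive.ofMul a, Additive.ofMul b],
   ExteriorAlgebra.ιMulti_range ℤ 2 (Set.mem_range_self _)⟩

def nuPBFree : FreeAbelianGroup RegT →+ L2CU :=
  FreeAbelianGroup.lift fun z : RegT =>
    2 • wedgeU (Units.mk0 z.1 z.2.1) (Units.mk0 (1 - z.1) (sub_ne_zero_of_ne (Ne.symm z.2.2)))

/-- The homomorphism `P(ℂ) → ℂ* ∧_ℤ ℂ*`, `[z] ↦ 2 (z ∧ (1-z))`. -/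
def nuPB : PreBloch →+ L2CU :=
  if h : ∀ a ∈ pbSub, nuPBFree a = 0 then QuotientAddGroup.lift pbSub nuPBFree h else 0

/-- The classical Bloch group `B(ℂ)`. -/
def Bloch : AddSubgroup PreBloch := nuPB.ker

/-- The roots of unity in `ℂ*`. -/
def muStar : Set ℂˣ := {ζ | ∃ n : ℕ, 0 < n ∧ ζ ^ n = 1}

abbrev SL2C := Matrix.SpecialLinearGroup (Fin 2) ℂ

/-- `PSL(2,ℂ) = SL(2,ℂ)/{±1}` as a discrete group. -/
abbrev PSL2C := SL2C ⧸ Subgroup.center SL2C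

/-- The boundary map `C₃ → C₂` of the inhomogeneous bar complex computing `H₃(PSL(2,ℂ);ℤ)`. -/
def d3 : FreeAbelianGroup (Fin 3 → PSL2C) →+ FreeAbelianGroup (Fin 2 → PSL2C) :=
  FreeAbelianGroup.lift fun g =>
    FreeAbelianGroup.of ![g 1, g 2] - FreeAbelianGroup.of ![g 0 * g 1, g 2] +
      FreeAbelianGroup.of ![g 0, g 1 * g 2] - FreeAbelianGroup.of ![g 0, g 1]

/-- The boundary map `C₄ → C₃` of the inhomogeneous bar complex computing `H₃(PSL(2,ℂ);ℤ)`. -/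
def d4 : FreeAbelianGroup (Fin 4 → PSL2C) →+ FreeAbelianGroup (Fin 3 → PSL2C) :=
  FreeAbelianGroup.lift fun g =>
    FreeAbelianGroup.of ![g 1, g 2, g 3] - FreeAbelianGroup.of ![g 0 * g 1, g 2, g 3] +
      FreeAbelianGroup.of ![g 0, g 1 * g 2, g 3] - FreeAbelianGroup.of ![g 0, g 1, g 2 * g 3] +
      FreeAbelianGroup.of ![g 0, g 1, g 2]

/-- `H₃(PSL(2,ℂ);ℤ)`, defined as homology of the inhomogeneous bar complex. -/
abbrev H3PSL2C : Type := ↥d3.ker ⧸ ((d4.range).addSubgroupOf d3.ker)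

/-- The set of combinatorial flattenings. -/
def Flattenings : Set (ℂ × ℂ × ℂ) :=
  {w | w.1 + w.2.1 + w.2.2 = 0 ∧ ∃ z : ℂ, Reg z ∧ ∃ p q r : ℤ,
    w.1 = Complex.log z + p * (Cpi * I) ∧
    w.2.1 = -Complex.log (1 - z) + q * (Cpi * I) ∧
    w.2.2 = Complex.log (1 - z) - Complex.log z + r * (Cpi * I)}

/-- The map `ℓ : 𝓒 → ℂ³`. -/
def ellMap (w : ℂ × ℂ) : ℂ × ℂ × ℂ := (w.1, w.2, -w.1 - w.2)

/-- The element `κ = [x,1,1] + [x,0,0] - [x,1,0] - [x,0,1] ∈ êP'(ℂ)`. -/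
def kap (x : ℂ) : EPreBloch' := cls' x 1 1 + cls' x 0 0 - cls' x 1 0 - cls' x 0 1

/-- The natural projection `êP'(ℂ) → êP(ℂ)`. -/
def projP : EPreBloch' →+ EPreBloch :=
  QuotientAddGroup.map relSub' relSub (AddMonoidHom.id _)
    (by
      rw [AddSubgroup.comap_id]
      exact AddSubgroup.closure_mono Set.subset_union_left)

/-- The pairs `(x, y)` parametrizing `FT`. -/
def ftParam : Set (ℂ × ℂ) := {u | Reg u.1 ∧ Reg u.2 ∧ u.1 ≠ u.2}

lemma reg_ftTuple {u : ℂ × ℂ} (hu : u ∈ ftParam) (i : Fin 5) : Reg (ftTuple u.1 u.2 i) := by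
  obtain ⟨x, y⟩ := u
  obtain ⟨⟨hx0, hx1⟩, ⟨hy0, hy1⟩, hxy⟩ := hu
  have hx1' : 1 - x ≠ 0 := sub_ne_zero_of_ne hx1.symm
  have hy1' : 1 - y ≠ 0 := sub_ne_zero_of_ne hy1.symm
  have hxi : 1 - x⁻¹ ≠ 0 := sub_ne_zero_of_ne fun h => hx1 (inv_eq_one.mp h.symm)
  have hyi : 1 - y⁻¹ ≠ 0 := sub_ne_zero_of_ne fun h => hy1 (inv_eq_one.mp h.symm)
  fin_cases i
  · exact ⟨hx0, hx1⟩
  · exact ⟨hy0, hy1⟩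
  · exact ⟨div_ne_zero hy0 hx0, fun h => hxy ((div_eq_one_iff_eq hx0).mp h).symm⟩
  · exact ⟨div_ne_zero hxi hyi, fun h => hxy (inv_injective
      (sub_right_injective ((div_eq_one_iff_eq hyi).mp h)))⟩
  · exact ⟨div_ne_zero hx1' hy1', fun h => hxy
      (sub_right_injective ((div_eq_one_iff_eq hy1').mp h))⟩

lemma continuousOn_ftTuple (i : Fin 5) :
    ContinuousOn (fun u : ℂ × ℂ => ftTuple u.1 u.2 i) ftParam := by
  have h1 : ContinuousOn (fun u : ℂ × ℂ => u.1) ftParam := continuousOn_fst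
  have h2 : ContinuousOn (fun u : ℂ × ℂ => u.2) ftParam := continuousOn_snd
  fin_cases i
  · exact h1
  · exact h2
  · exact h2.div h1 fun u hu => hu.1.1
  · exact (continuousOn_const.sub (h1.inv₀ fun u hu => hu.1.1)).div
      (continuousOn_const.sub (h2.inv₀ fun u hu => hu.2.1.1))
      fun u hu => sub_ne_zero_of_ne fun h => hu.2.1.2 (inv_eq_one.mp h.symm)
  · exact (continuousOn_const.sub h1).div (continuousOn_const.sub h2)
      fun u hu => sub_ne_zero_of_ne hu.2.1.2.symm

lemma liesOver_of_exp {z a b : ℂ} (hz : Reg z) (ha : exp a = z) (hb : exp b = 1 - z) :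
    LiesOver (a, -b) z := by
  have hz1 : 1 - z ≠ 0 := sub_ne_zero_of_ne hz.2.symm
  obtain ⟨m, hm⟩ := exp_eq_exp_iff_exists_int.mp (ha.trans (exp_log hz.1).symm)
  obtain ⟨n, hn⟩ := exp_eq_exp_iff_exists_int.mp (hb.trans (exp_log hz1).symm)
  refine ⟨hz, 2 * m, -(2 * n), Prod.ext ?_ ?_⟩
  · simp only [pt, Cpi, hm]; push_cast; ring
  · simp only [pt, Cpi, hn]; push_cast; ring

/-- A path in `ℂ ∖ {0}` has a continuous logarithm with prescribed initial value. -/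
lemma exists_log_path {f : unitInterval → ℂ} (hf : Continuous f) (h0 : ∀ t, f t ≠ 0) :
    ∃ g : unitInterval → ℂ, Continuous g ∧ (∀ t, exp (g t) = f t) ∧ g 0 = log (f 0) := by
  obtain ⟨Γ, hΓ, hΓ0⟩ := isCoveringMap_exp.exists_path_lifts
    (⟨fun t => ⟨f t, h0 t⟩, hf.subtype_mk _⟩ : C(unitInterval, {z : ℂ // z ≠ 0})) (log (f 0))
    (Subtype.ext (exp_log (h0 0)).symm)
  exact ⟨Γ, Γ.continuous, fun t => congrArg Subtype.val (congrFun hΓ t), hΓ0⟩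

lemma joinedIn_compl_finite {s : Set ℂ} (hs : s.Finite) {a b : ℂ} (ha : a ∉ s) (hb : b ∉ s) :
    JoinedIn sᶜ a b :=
  (hs.countable.isPathConnected_compl_of_one_lt_rank (by simp)).joinedIn a ha b hb

lemma base_mem_ftParam : (((1 + I) / 4, I) : ℂ × ℂ) ∈ ftParam := by
  refine ⟨⟨fun h => ?_, fun h => ?_⟩, ⟨I_ne_zero, fun h => ?_⟩, fun h => ?_⟩
  · simpa using congrArg im h
  · simpa using congrArg im h
  · simpa using congrArg im h
  · simpa using congrArg re h

/-- Every `x ∈ ℂ ∖ {0,1}` is the first coordinate of a parameter joined to the base parameter. -/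
lemma exists_joinedIn_ftParam {x : ℂ} (hx : Reg x) :
    ∃ y, JoinedIn ftParam ((1 + I) / 4, I) (x, y) := by
  obtain ⟨y, hy⟩ := (Set.toFinite {0, 1, (1 + I) / 4, x}).exists_notMem
  simp only [Set.mem_insert_iff, Set.mem_singleton_iff, not_or] at hy
  obtain ⟨hy0, hy1, hyb, hyx⟩ := hy
  obtain ⟨hb, hI, hbI⟩ := base_mem_ftParam
  have A : JoinedIn ({0, 1, (1 + I) / 4} : Set ℂ)ᶜ I y :=
    joinedIn_compl_finite (Set.toFinite _)
      (by simpa only [Set.mem_insert_iff, Set.mem_singleton_iff, not_or] using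
        ⟨hI.1, hI.2, hbI.symm⟩)
      (by simpa only [Set.mem_insert_iff, Set.mem_singleton_iff, not_or] using ⟨hy0, hy1, hyb⟩)
  have B : JoinedIn ({0, 1, y} : Set ℂ)ᶜ ((1 + I) / 4) x :=
    joinedIn_compl_finite (Set.toFinite _)
      (by simpa only [Set.mem_insert_iff, Set.mem_singleton_iff, not_or] using
        ⟨hb.1, hb.2, Ne.symm hyb⟩)
      (by simpa only [Set.mem_insert_iff, Set.mem_singleton_iff, not_or] using
        ⟨hx.1, hx.2, Ne.symm hyx⟩)
  refine ⟨y, JoinedIn.trans (y := ((1 + I) / 4, y)) ?_ ?_⟩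
  · refine ⟨A.somePath.map (f := fun w => ((1 + I) / 4, w)) (by fun_prop), fun t => ?_⟩
    have h := A.somePath_mem t
    simp only [Set.mem_compl_iff, Set.mem_insert_iff, Set.mem_singleton_iff, not_or] at h
    exact ⟨hb, ⟨h.1, h.2.1⟩, Ne.symm h.2.2⟩
  · refine ⟨B.somePath.map (f := fun w => (w, y)) (by fun_prop), fun t => ?_⟩
    have h := B.somePath_mem t
    simp only [Set.mem_compl_iff, Set.mem_insert_iff, Set.mem_singleton_iff, not_or] at h
    exact ⟨⟨h.1, h.2.1⟩, ⟨hy0, hy1⟩, h.2.2⟩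

lemma exists_mem_FThat₀ {x y : ℂ} (h : JoinedIn ftParam ((1 + I) / 4, I) (x, y)) :
    ∃ w ∈ FThat₀, ∀ i, LiesOver (w i) (ftTuple x y i) := by
  obtain ⟨γ, hγ⟩ := h
  have hc (i : Fin 5) : Continuous fun t => ftTuple (γ t).1 (γ t).2 i :=
    (continuousOn_ftTuple i).comp_continuous γ.continuous hγ
  choose a ha hae ha0 using fun i =>
    exists_log_path (hc i) fun t => (reg_ftTuple (hγ t) i).1
  choose b hb hbe hb0 using fun i =>
    exists_log_path (continuous_const.sub (hc i)) fun t =>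
      sub_ne_zero_of_ne (reg_ftTuple (hγ t) i).2.symm
  let W : unitInterval → Fin 5 → ℂ × ℂ := fun t i => (a i t, -b i t)
  have hW : Continuous W := continuous_pi fun i => (ha i).prodMk (hb i).neg
  have hover (t i) : LiesOver (W t i) (ftTuple (γ t).1 (γ t).2 i) :=
    liesOver_of_exp (reg_ftTuple (hγ t) i) (hae i t) (hbe i t)
  have h0 : W 0 = basePt := by
    funext i
    simp [W, basePt, pt, ha0, hb0]
  have hsub : Set.range W ⊆ FThat₀ :=
    (isPreconnected_range hW).subset_connectedComponentIn ⟨0, h0⟩ <| by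
      rintro _ ⟨t, rfl⟩
      exact ⟨_, ⟨_, _, (hγ t).1, (hγ t).2.1, (hγ t).2.2, rfl⟩, hover t⟩
  exact ⟨W 1, hsub ⟨1, rfl⟩, by simpa using hover 1⟩

lemma covAct_pt (z : ℂ) (p q m n : ℤ) : covAct (m, n) (pt z p q) = pt z (p + m) (q + n) := by
  ext <;> simp only [covAct, pt] <;> push_cast <;> ring

/-- The lifted five term relation over a point of `FThat₀`, translated by an element of `V`. -/
lemma five_term {w : Fin 5 → ℂ × ℂ} (hw : w ∈ FThat₀) {z : Fin 5 → ℂ} (hz : ∀ i, Reg (z i))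
    {P Q : Fin 5 → ℤ} (hwz : ∀ i, w i = pt (z i) (P i) (Q i)) (a b c d e : ℤ) :
    cls' (z 0) (P 0 + a) (Q 0 + b) - cls' (z 1) (P 1 + c) (Q 1 + d)
      + cls' (z 2) (P 2 + (c - a)) (Q 2 + e)
      - cls' (z 3) (P 3 + (c - a + d - b)) (Q 3 + (e - d))
      + cls' (z 4) (P 4 + (d - b)) (Q 4 + (e - d - a)) = 0 := by
  let v : Fin 5 → ℤ × ℤ :=
    ![(a, b), (c, d), (c - a, e), (c - a + d - b, e - d), (d - b, e - d - a)]
  have hu (i) : covAct (v i) (w i) = pt (z i) (P i + (v i).1) (Q i + (v i).2) := by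
    rw [hwz, ← covAct_pt]
  have hmem : ∑ i : Fin 5, (-1 : ℤ) ^ (i : ℕ) •
      genOf (z i) (hz i) (P i + (v i).1) (Q i + (v i).2) ∈ relSub' := by
    refine AddSubgroup.subset_closure ⟨fun i => covAct (v i) (w i),
      ⟨w, hw, v, ⟨a, c, b, d, e, rfl⟩, rfl⟩, fun i => ⟨z i, hz i, _, _, hu i⟩, ?_⟩
    simp only [genOf, hu]
  have hq := (QuotientAddGroup.eq_zero_iff _).mpr hmem
  rw [← QuotientAddGroup.mk'_apply, map_sum] at hq
  simp only [map_zsmul, QuotientAddGroup.mk'_apply] at hq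
  have hcls (i) (m n : ℤ) :
      (QuotientAddGroup.mk (genOf (z i) (hz i) m n) : EPreBloch') = cls' (z i) m n := by
    rw [cls', dif_pos (hz i)]
  simp only [hcls, Fin.sum_univ_five] at hq
  simpa [v, ← sub_eq_add_neg, pow_succ] using hq

/-- The combinatorial core: a function on `ℤ × ℤ` occurring as first term of the translated five
term relations is affine in the three directions `(0,1)`, `(1,0)` and `(1,-1)`. -/
lemma affine_of_five_term {M : Type*} [AddCommGroup M] {f₀ f₁ f₂ f₃ f₄ : ℤ → ℤ → M}
    (H : ∀ a b c d e, f₀ a b - f₁ c d + f₂ (c - a) e - f₃ (c - a + d - b) (e - d)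
      + f₄ (d - b) (e - d - a) = 0) (p q p' q' s : ℤ) :
    (f₀ p q - f₀ p q' = f₀ p (q - 1) - f₀ p (q' - 1)) ∧
    (f₀ p q - f₀ p' q = f₀ (p - 1) q - f₀ (p' - 1) q) ∧
    (f₀ p q - f₀ (p + s) (q - s) = f₀ (p + 1) (q - 1) - f₀ (p + s + 1) (q - s - 1)) := by
  refine ⟨?_, ?_, ?_⟩
  · have h1 := H p q 0 0 0
    have h2 := H p q' 0 0 0
    have h3 := H p (q - 1) 0 (-1) (-1)
    have h4 := H p (q' - 1) 0 (-1) (-1)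
    grind
  · have h1 := H p q p 0 0
    have h2 := H p' q p' 0 0
    have h3 := H (p - 1) q p 0 (-1)
    have h4 := H (p' - 1) q p' 0 (-1)
    grind
  · have h1 := H p q 0 0 0
    have h2 := H (p + s) (q - s) 0 0 0
    have h3 := H (p + 1) (q - 1) 1 (-1) 0
    have h4 := H (p + s + 1) (q - s - 1) 1 (-1) 0
    grind

/-- the three families of identities in `êP'(ℂ)` (no transfer relations). -/
theorem stmt12 (x : ℂ) (h0 : x ≠ 0) (h1 : x ≠ 1) (p q p' q' s : ℤ) :
    (cls' x p q - cls' x p q' = cls' x p (q - 1) - cls' x p (q' - 1)) ∧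
    (cls' x p q - cls' x p' q = cls' x (p - 1) q - cls' x (p' - 1) q) ∧
    (cls' x p q - cls' x (p + s) (q - s) =
      cls' x (p + 1) (q - 1) - cls' x (p + s + 1) (q - s - 1)) := by
  obtain ⟨y, hy⟩ := exists_joinedIn_ftParam ⟨h0, h1⟩
  obtain ⟨w, hw, hover⟩ := exists_mem_FThat₀ hy
  choose hz P Q hwz using hover
  have key := affine_of_five_term (f₀ := fun m n => cls' x (P 0 + m) (Q 0 + n))
    (f₁ := fun m n => cls' (ftTuple x y 1) (P 1 + m) (Q 1 + n))
    (f₂ := fun m n => cls' (ftTuple x y 2) (P 2 + m) (Q 2 + n))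
    (f₃ := fun m n => cls' (ftTuple x y 3) (P 3 + m) (Q 3 + n))
    (f₄ := fun m n => cls' (ftTuple x y 4) (P 4 + m) (Q 4 + n))
    (five_term hw hz hwz) (p - P 0) (q - Q 0) (p' - P 0) (q' - Q 0) s
  simpa only [← add_sub_assoc, ← add_assoc, add_sub_cancel_left, add_sub_cancel] using key

end ExtendedBloch

end
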